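/- arXiv:1606.06993 — 2 statements merged into one kernel-verified Lean document; each statement's English description precedes it below -/
import Mathlib

section
/- For nonnegative integers r₁, r₂ and real parameters μ₁, μ₂ and σ₁, σ₂ > 0, ∫_{-∞}^{∞} φ^{(r₁)}(x; μ₁, σ₁²) φ^{(r₂)}(x; μ₂, σ₂²) dx = (-1)^{r₁} φ^{(r₁+r₂)}(μ₁ - μ₂; 0, σ₁² + σ₂²). -/
open Real MeasureTheory

noncomputable def stdNormalPDF (x : ℝ) : ℝ := (Real.sqrt (2 * Real.pi))⁻¹ * Real.exp (-x ^ 2 / 2)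

/-- r-th derivative in x of the normal density with mean μ and standard deviation σ:
    φ^{(r)}(x; μ, σ²) = σ^{-(r+1)} φ^{(r)}((x-μ)/σ). -/
noncomputable def normalDeriv (r : ℕ) (μ σ x : ℝ) : ℝ :=
  σ⁻¹ ^ (r + 1) * iteratedDeriv r stdNormalPDF ((x - μ) / σ)

lemma aux_contDiff : ContDiff ℝ ⊤ stdNormalPDF := by
  unfold stdNormalPDF
  fun_prop

lemma aux_D_hasDeriv (r : ℕ) (x : ℝ) :
    HasDerivAt (iteratedDeriv r stdNormalPDF) (iteratedDeriv (r + 1) stdNormalPDF x) x := by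
  rw [iteratedDeriv_succ]
  apply DifferentiableAt.hasDerivAt
  exact (aux_contDiff.differentiable_iteratedDeriv r (by exact_mod_cast WithTop.coe_lt_top _)) x

lemma aux_D_poly (r : ℕ) : ∃ P : Polynomial ℝ, ∀ x,
    iteratedDeriv r stdNormalPDF x = P.eval x * Real.exp (-(1 / 2) * x ^ 2) := by
  induction r with
  | zero =>
    refine ⟨Polynomial.C (Real.sqrt (2 * Real.pi))⁻¹, fun x => ?_⟩
    simp only [iteratedDeriv_zero, stdNormalPDF, Polynomial.eval_C]
    congr 2; ring
  | succ r ih =>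
    obtain ⟨P, hP⟩ := ih
    refine ⟨Polynomial.derivative P - Polynomial.X * P, fun x => ?_⟩
    rw [iteratedDeriv_succ, funext hP]
    have h1 : HasDerivAt (fun x : ℝ => -(1 / 2) * x ^ 2) (-x) x := by
      have := (hasDerivAt_pow 2 x).const_mul (-(1 / 2) : ℝ)
      refine this.congr_deriv ?_
      norm_num; ring
    have := (P.hasDerivAt x).mul h1.exp
    refine (this.deriv).trans ?_
    simp; ring

lemma aux_poly_integrable (P : Polynomial ℝ) :
    Integrable (fun x : ℝ => P.eval x * Real.exp (-(1 / 2) * x ^ 2)) := by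
  induction P using Polynomial.induction_on' with
  | add p q hp hq =>
    refine (hp.add hq).congr (Filter.Eventually.of_forall fun x => ?_)
    simp [add_mul]
  | monomial n a =>
    have := (integrable_rpow_mul_exp_neg_mul_sq (b := 1 / 2) (by norm_num) (s := n)
      (by have : (0 : ℝ) ≤ n := n.cast_nonneg
          linarith)).const_mul a
    simpa [mul_assoc] using this

lemma aux_poly_bounded (P : Polynomial ℝ) :
    ∃ C, ∀ x : ℝ, |P.eval x * Real.exp (-(1 / 2) * x ^ 2)| ≤ C := by
  induction P using Polynomial.induction_on' with
  | add p q hp hq =>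
    obtain ⟨C, hC⟩ := hp
    obtain ⟨D, hD⟩ := hq
    refine ⟨C + D, fun x => ?_⟩
    rw [Polynomial.eval_add, add_mul]
    exact (abs_add_le _ _).trans (add_le_add (hC x) (hD x))
  | monomial n a =>
    refine ⟨|a| * (n.factorial * Real.exp (1 / 2)), fun x => ?_⟩
    rw [Polynomial.eval_monomial, mul_assoc, abs_mul]
    gcongr
    rw [abs_mul, abs_pow, Real.abs_exp]
    have h := Real.pow_div_factorial_le_exp |x| (abs_nonneg x) n
    rw [div_le_iff₀ (by positivity)] at h
    calc |x| ^ n * Real.exp (-(1 / 2) * x ^ 2)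
        ≤ (Real.exp |x| * n.factorial) * Real.exp (-(1 / 2) * x ^ 2) := by gcongr
      _ = n.factorial * Real.exp (|x| + -(1 / 2) * x ^ 2) := by rw [Real.exp_add]; ring
      _ ≤ _ := by
        gcongr
        nlinarith [sq_nonneg (|x| - 1), sq_abs x]

lemma aux_N_hasDeriv (r : ℕ) (μ σ x : ℝ) :
    HasDerivAt (normalDeriv r μ σ) (normalDeriv (r + 1) μ σ x) x := by
  have h1 : HasDerivAt (fun x : ℝ => (x - μ) / σ) (1 / σ) x :=
    ((hasDerivAt_id x).sub_const μ).div_const σ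
  have := ((aux_D_hasDeriv r ((x - μ) / σ)).comp x h1).const_mul (σ⁻¹ ^ (r + 1))
  refine this.congr_deriv ?_
  unfold normalDeriv
  ring

lemma aux_N_hasDeriv_mean (r : ℕ) (μ σ x : ℝ) :
    HasDerivAt (fun m => normalDeriv r m σ x) (-normalDeriv (r + 1) μ σ x) μ := by
  have h1 : HasDerivAt (fun m : ℝ => (x - m) / σ) (-1 / σ) μ :=
    ((hasDerivAt_id μ).const_sub x).div_const σ
  have := ((aux_D_hasDeriv r ((x - μ) / σ)).comp μ h1).const_mul (σ⁻¹ ^ (r + 1))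
  refine this.congr_deriv ?_
  unfold normalDeriv
  ring

lemma aux_N_bounded (r : ℕ) (σ : ℝ) : ∃ C, ∀ μ x, |normalDeriv r μ σ x| ≤ C := by
  obtain ⟨P, hP⟩ := aux_D_poly r
  obtain ⟨C, hC⟩ := aux_poly_bounded P
  refine ⟨|σ⁻¹ ^ (r + 1)| * C, fun μ x => ?_⟩
  unfold normalDeriv
  rw [abs_mul, hP]
  gcongr
  exact hC _

lemma aux_N_integrable (r : ℕ) (μ σ : ℝ) (hσ : 0 < σ) : Integrable (normalDeriv r μ σ) := by
  obtain ⟨P, hP⟩ := aux_D_poly r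
  have h := aux_poly_integrable P
  rw [← funext hP] at h
  exact ((h.comp_div hσ.ne').comp_sub_right μ).const_mul _

lemma aux_N_cont (r : ℕ) (μ σ : ℝ) : Continuous (normalDeriv r μ σ) :=
  continuous_iff_continuousAt.2 fun x => (aux_N_hasDeriv r μ σ x).continuousAt

lemma aux_NN_integrable (r s : ℕ) (μ ν σ τ : ℝ) (hσ : 0 < σ) :
    Integrable (fun x => normalDeriv r μ σ x * normalDeriv s ν τ x) := by
  obtain ⟨C, hC⟩ := aux_N_bounded s τ
  exact (aux_N_integrable r μ σ hσ).mul_bdd (c := C) (aux_N_cont s ν τ).aestronglyMeasurable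
    (Filter.Eventually.of_forall fun x => hC ν x)

lemma aux_base (μ₁ μ₂ σ₁ σ₂ : ℝ) (hσ₁ : 0 < σ₁) (hσ₂ : 0 < σ₂) :
    ∫ x : ℝ, normalDeriv 0 μ₁ σ₁ x * normalDeriv 0 μ₂ σ₂ x
      = normalDeriv 0 0 (Real.sqrt (σ₁ ^ 2 + σ₂ ^ 2)) (μ₁ - μ₂) := by
  have hs : 0 < σ₁ ^ 2 + σ₂ ^ 2 := by positivity
  set s := Real.sqrt (σ₁ ^ 2 + σ₂ ^ 2) with hsdef
  have hs0 : 0 < s := Real.sqrt_pos.2 hs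
  have hs2 : s ^ 2 = σ₁ ^ 2 + σ₂ ^ 2 := Real.sq_sqrt hs.le
  set q := Real.sqrt (2 * Real.pi) with hq
  have hq0 : 0 < q := Real.sqrt_pos.2 (by positivity)
  set b := s ^ 2 / (2 * σ₁ ^ 2 * σ₂ ^ 2) with hb
  set m := (μ₁ * σ₂ ^ 2 + μ₂ * σ₁ ^ 2) / (σ₁ ^ 2 + σ₂ ^ 2) with hm
  have key : ∀ x, normalDeriv 0 μ₁ σ₁ x * normalDeriv 0 μ₂ σ₂ x
      = (σ₁⁻¹ * σ₂⁻¹ * q⁻¹ * q⁻¹ * Real.exp (-((μ₁ - μ₂) / s) ^ 2 / 2)) *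
        Real.exp (-b * (x - m) ^ 2) := by
    intro x
    have e : Real.exp (-((x - μ₁) / σ₁) ^ 2 / 2) * Real.exp (-((x - μ₂) / σ₂) ^ 2 / 2)
        = Real.exp (-((μ₁ - μ₂) / s) ^ 2 / 2) * Real.exp (-b * (x - m) ^ 2) := by
      rw [← Real.exp_add, ← Real.exp_add]
      congr 1
      rw [div_pow (μ₁ - μ₂), hb, hs2, hm]
      field_simp
      ring
    simp only [normalDeriv, iteratedDeriv_zero, stdNormalPDF, zero_add, pow_one, ← hq]
    linear_combination (σ₁⁻¹ * σ₂⁻¹ * q⁻¹ * q⁻¹) * e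
  simp_rw [key]
  rw [integral_const_mul, integral_sub_right_eq_self (fun x => Real.exp (-b * x ^ 2)) m,
    integral_gaussian]
  have hbs : Real.sqrt (Real.pi / b) = q * (σ₁ * σ₂ / s) := by
    rw [Real.sqrt_eq_iff_mul_self_eq_of_pos (by positivity)]
    have hq2 : q ^ 2 = 2 * Real.pi := Real.sq_sqrt (by positivity)
    rw [hb]
    field_simp
    rw [hq2, mul_comm]
  rw [hbs]
  simp only [normalDeriv, iteratedDeriv_zero, stdNormalPDF, zero_add, pow_one, ← hq, sub_zero]
  field_simp

lemma aux_left_zero (n : ℕ) (μ₁ σ₁ σ₂ : ℝ) (hσ₁ : 0 < σ₁) (hσ₂ : 0 < σ₂) : ∀ μ₂ : ℝ,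
    ∫ x : ℝ, normalDeriv 0 μ₁ σ₁ x * normalDeriv n μ₂ σ₂ x
      = normalDeriv n 0 (Real.sqrt (σ₁ ^ 2 + σ₂ ^ 2)) (μ₁ - μ₂) := by
  induction n with
  | zero => exact fun μ₂ => aux_base μ₁ μ₂ σ₁ σ₂ hσ₁ hσ₂
  | succ n ih =>
    intro μ₂
    obtain ⟨C, hC⟩ := aux_N_bounded (n + 1) σ₂
    have h := (hasDerivAt_integral_of_dominated_loc_of_deriv_le (μ := volume)
      (F := fun m x => normalDeriv 0 μ₁ σ₁ x * normalDeriv n m σ₂ x)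
      (F' := fun m x => normalDeriv 0 μ₁ σ₁ x * -normalDeriv (n + 1) m σ₂ x)
      (x₀ := μ₂) (s := Set.univ) (bound := fun x => |normalDeriv 0 μ₁ σ₁ x| * C)
      Filter.univ_mem
      (Filter.Eventually.of_forall fun m =>
        (aux_NN_integrable 0 n μ₁ m σ₁ σ₂ hσ₁).aestronglyMeasurable)
      (aux_NN_integrable 0 n μ₁ μ₂ σ₁ σ₂ hσ₁)
      (((aux_N_cont 0 μ₁ σ₁).mul (aux_N_cont (n + 1) μ₂ σ₂).neg).aestronglyMeasurable)
      (Filter.Eventually.of_forall fun x m _ => by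
        rw [Real.norm_eq_abs, abs_mul, abs_neg]
        gcongr
        exact hC m x)
      ((aux_N_integrable 0 μ₁ σ₁ hσ₁).abs.mul_const C)
      (Filter.Eventually.of_forall fun x m _ =>
        (aux_N_hasDeriv_mean n m σ₂ x).const_mul _)).2
    simp only [ih] at h
    have h2 := (aux_N_hasDeriv n 0 (Real.sqrt (σ₁ ^ 2 + σ₂ ^ 2)) (μ₁ - μ₂)).comp μ₂
      ((hasDerivAt_id μ₂).const_sub μ₁)
    have h3 := h.unique h2
    simp only [mul_neg, integral_neg] at h3
    linarith

theorem convolution_normal_derivs (r₁ r₂ : ℕ) (μ₁ μ₂ σ₁ σ₂ : ℝ)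
    (hσ₁ : 0 < σ₁) (hσ₂ : 0 < σ₂) :
    ∫ x : ℝ, normalDeriv r₁ μ₁ σ₁ x * normalDeriv r₂ μ₂ σ₂ x
      = (-1 : ℝ) ^ r₁ *
          normalDeriv (r₁ + r₂) 0 (Real.sqrt (σ₁ ^ 2 + σ₂ ^ 2)) (μ₁ - μ₂) := by
  induction r₁ generalizing r₂ with
  | zero => simpa using aux_left_zero r₂ μ₁ σ₁ σ₂ hσ₁ hσ₂ μ₂
  | succ r ih =>
    have h := integral_mul_deriv_eq_deriv_mul_of_integrable
      (u := normalDeriv r μ₁ σ₁) (v := normalDeriv r₂ μ₂ σ₂)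
      (u' := normalDeriv (r + 1) μ₁ σ₁) (v' := normalDeriv (r₂ + 1) μ₂ σ₂)
      (fun x _ => aux_N_hasDeriv r μ₁ σ₁ x) (fun x _ => aux_N_hasDeriv r₂ μ₂ σ₂ x)
      (aux_NN_integrable r (r₂ + 1) μ₁ μ₂ σ₁ σ₂ hσ₁)
      (aux_NN_integrable (r + 1) r₂ μ₁ μ₂ σ₁ σ₂ hσ₁)
      (aux_NN_integrable r r₂ μ₁ μ₂ σ₁ σ₂ hσ₁)
    rw [ih] at h
    have e : r + 1 + r₂ = r + (r₂ + 1) := by ring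
    rw [e, pow_succ]
    linarith
end

section
/- Let F be the cdf of a finite normal mixture with weights w_j > 0 summing to 1, means μ_j, and standard deviations σ_j > 0, j = 1,…,m. Then ∫_{-∞}^{∞} F(x)(1 - F(x)) dx = Σ_{i=1}^m Σ_{j=1}^m w_i w_j [σ_{ij} φ((μ_i - μ_j)/σ_{ij}) + (μ_i - μ_j) Φ((μ_i - μ_j)/σ_{ij})], where σ_{ij} = √(σ_i² + σ_j²). -/
open Real MeasureTheory Finset

noncomputable def stdNormalCDF (x : ℝ) : ℝ := ∫ u in Set.Iic x, stdNormalPDF u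

open ProbabilityTheory in
/-- The normal law with mean `m` and standard deviation `s`. -/
noncomputable def nrm (m s : ℝ) : Measure ℝ := gaussianReal m (.mk (s ^ 2) (sq_nonneg _))

open ProbabilityTheory in
instance nrm_prob (m s : ℝ) : IsProbabilityMeasure (nrm m s) := by
  unfold nrm; infer_instance

open ProbabilityTheory in
lemma stdPDF_eq : stdNormalPDF = gaussianPDFReal 0 1 := by
  ext x; simp [stdNormalPDF, gaussianPDFReal]

open ProbabilityTheory in
lemma stdPDF_int : Integrable stdNormalPDF := by
  rw [stdPDF_eq]; exact integrable_gaussianPDFReal _ _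

lemma stdPDF_nonneg (x : ℝ) : 0 ≤ stdNormalPDF x := by unfold stdNormalPDF; positivity

lemma stdPDF_neg (x : ℝ) : stdNormalPDF (-x) = stdNormalPDF x := by simp [stdNormalPDF]

lemma stdCDF_nonneg (x : ℝ) : 0 ≤ stdNormalCDF x :=
  integral_nonneg fun _ => stdPDF_nonneg _

open ProbabilityTheory in
lemma nrm_map (m s : ℝ) :
    nrm m s = (gaussianReal 0 1).map (fun z => s * z + m) := by
  have : (fun z : ℝ => s * z + m) = (fun x => x + m) ∘ (fun z => s * z) := by ext; simp
  rw [this, ← Measure.map_map (by fun_prop) (by fun_prop), gaussianReal_map_const_mul,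
    gaussianReal_map_add_const]
  simp [nrm]

open ProbabilityTheory in
lemma nrm_Iic (m s : ℝ) (hs : 0 < s) (x : ℝ) :
    nrm m s (Set.Iic x) = ENNReal.ofReal (stdNormalCDF ((x - m) / s)) := by
  rw [nrm_map, Measure.map_apply (by fun_prop) measurableSet_Iic]
  have : (fun z : ℝ => s * z + m) ⁻¹' Set.Iic x = Set.Iic ((x - m) / s) := by
    ext z
    simp only [Set.mem_preimage, Set.mem_Iic]
    rw [le_div_iff₀ hs]
    constructor <;> intro h <;> linarith
  rw [this, gaussianReal_apply_eq_integral _ one_ne_zero, ← stdPDF_eq]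
  rfl

lemma stdCDF_le_one (x : ℝ) : stdNormalCDF x ≤ 1 := by
  have h := nrm_Iic 0 1 one_pos x
  have h2 : nrm 0 1 (Set.Iic x) ≤ 1 := prob_le_one
  rw [h] at h2
  simpa using h2

lemma stdCDF_mono : Monotone stdNormalCDF := by
  intro x y h
  exact setIntegral_mono_set stdPDF_int.integrableOn
    (Filter.Eventually.of_forall stdPDF_nonneg) (Set.Iic_subset_Iic.2 h).eventuallyLE

lemma nrm_Ioi (m s : ℝ) (hs : 0 < s) (x : ℝ) :
    nrm m s (Set.Ioi x) = ENNReal.ofReal (1 - stdNormalCDF ((x - m) / s)) := by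
  rw [← Set.compl_Iic, prob_compl_eq_one_sub measurableSet_Iic, nrm_Iic m s hs,
    ENNReal.ofReal_sub _ (stdCDF_nonneg _)]
  simp

lemma stdPDF_deriv (x : ℝ) : HasDerivAt (fun z => -stdNormalPDF z) (x * stdNormalPDF x) x := by
  unfold stdNormalPDF
  have h1 : HasDerivAt (fun z : ℝ => -z ^ 2 / 2) (-x) x := by
    have := ((hasDerivAt_pow 2 x).neg).div_const 2
    exact this.congr_deriv (by norm_num; ring)
  have := ((h1.exp).const_mul (√(2 * π))⁻¹).neg
  exact this.congr_deriv (by ring)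

lemma mul_stdPDF_int : Integrable (fun z => z * stdNormalPDF z) := by
  have := (integrable_mul_exp_neg_mul_sq (b := 1 / 2) (by norm_num)).const_mul (√(2 * π))⁻¹
  convert this using 2 with z
  unfold stdNormalPDF
  rw [show -(1 / 2) * z ^ 2 = -z ^ 2 / 2 by ring]
  ring

lemma stdPDF_tendsto : Filter.Tendsto (fun z => -stdNormalPDF z) Filter.atTop (nhds 0) := by
  have h1 : Filter.Tendsto (fun z : ℝ => -z ^ 2 / 2) Filter.atTop Filter.atBot := by
    have h : Filter.Tendsto (fun z : ℝ => z ^ 2 / 2) Filter.atTop Filter.atTop :=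
      (Filter.tendsto_pow_atTop two_ne_zero).atTop_div_const (by norm_num)
    convert Filter.tendsto_neg_atTop_atBot.comp h using 2 with z
    simp [neg_div]
  have := ((Real.tendsto_exp_atBot.comp h1).const_mul (√(2 * π))⁻¹).neg
  simpa [stdNormalPDF, Function.comp_def] using this

lemma int_Ioi_mul (a : ℝ) : ∫ z in Set.Ioi (-a), z * stdNormalPDF z = stdNormalPDF a := by
  rw [integral_Ioi_of_hasDerivAt_of_tendsto (stdPDF_deriv _).continuousAt.continuousWithinAt
    (fun x _ => stdPDF_deriv x) mul_stdPDF_int.integrableOn stdPDF_tendsto, stdPDF_neg]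
  ring

lemma int_Ioi (a : ℝ) : ∫ z in Set.Ioi (-a), stdNormalPDF z = stdNormalCDF a := by
  rw [← integral_comp_neg_Iic]
  simp [stdPDF_neg, stdNormalCDF]

/-- The value `E[(s Z + d)^+]`. -/
noncomputable def val (d s : ℝ) : ℝ := s * stdNormalPDF (d / s) + d * stdNormalCDF (d / s)

open ProbabilityTheory in
lemma int_pos_part (d s : ℝ) (hs : 0 < s) :
    ∫ z, max (s * z + d) 0 ∂(gaussianReal 0 1) = val d s := by
  rw [integral_gaussianReal_eq_integral_smul one_ne_zero, ← stdPDF_eq]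
  have : (fun z => stdNormalPDF z • max (s * z + d) 0) = (Set.Ioi (-(d / s))).indicator
      (fun z => s * (z * stdNormalPDF z) + d * stdNormalPDF z) := by
    ext z
    have e : z * s + d = (z + d / s) * s := by field_simp
    by_cases hz : z ∈ Set.Ioi (-(d / s))
    · rw [Set.indicator_of_mem hz, max_eq_left]
      · simp only [smul_eq_mul]; ring
      · rw [mul_comm, e]
        have : 0 < z + d / s := by simp only [Set.mem_Ioi] at hz; linarith
        positivity
    · rw [Set.indicator_of_notMem hz, max_eq_right]
      · simp
      · rw [mul_comm, e]
        have : z + d / s ≤ 0 := by simp only [Set.mem_Ioi] at hz; linarith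
        exact mul_nonpos_of_nonpos_of_nonneg this hs.le
  rw [this, integral_indicator measurableSet_Ioi,
    integral_add (mul_stdPDF_int.const_mul s).integrableOn (stdPDF_int.const_mul d).integrableOn,
    integral_const_mul, integral_const_mul, int_Ioi_mul, int_Ioi]
  rfl

lemma val_nonneg (d s : ℝ) (hs : 0 < s) : 0 ≤ val d s := by
  rw [← int_pos_part d s hs]
  exact integral_nonneg fun _ => le_max_right _ _

open ProbabilityTheory in
lemma lint_nrm (d s : ℝ) (hs : 0 < s) :
    ∫⁻ z, ENNReal.ofReal z ∂(nrm d s) = ENNReal.ofReal (val d s) := by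
  rw [nrm_map, lintegral_map (by fun_prop) (by fun_prop), ← int_pos_part d s hs,
    ofReal_integral_eq_lintegral_ofReal]
  · congr 1; ext z; simp [ENNReal.ofReal_max]
  · have h : Integrable (fun z : ℝ => z) (gaussianReal 0 1) :=
      (memLp_id_gaussianReal 1).integrable (by simp)
    exact ((h.const_mul s).add (integrable_const d)).pos_part
  · exact Filter.Eventually.of_forall fun _ => le_max_right _ _

open ProbabilityTheory in
lemma map_sub_nrm (m₁ s₁ m₂ s₂ : ℝ) :
    ((nrm m₁ s₁).prod (nrm m₂ s₂)).map (fun p => p.2 - p.1)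
      = nrm (m₂ - m₁) (√(s₁ ^ 2 + s₂ ^ 2)) := by
  have h : (nrm m₁ s₁).map (fun x => -x) = nrm (-m₁) s₁ := gaussianReal_map_neg
  have h2 : Measure.conv (nrm (-m₁) s₁) (nrm m₂ s₂) = nrm (m₂ - m₁) (√(s₁ ^ 2 + s₂ ^ 2)) := by
    unfold nrm
    rw [gaussianReal_conv_gaussianReal]
    congr 1
    · ring
    · ext
      simp only [NNReal.coe_add, NNReal.coe_mk]
      rw [Real.sq_sqrt (by positivity)]
  rw [← h2, ← h, Measure.conv]
  conv_rhs => rw [← Measure.map_id (μ := nrm m₂ s₂)]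
  rw [Measure.map_prod_map _ _ (by fun_prop) (by fun_prop),
    Measure.map_map (by fun_prop) (by fun_prop)]
  congr 1
  ext p
  simp
  ring

lemma lint_key (m₁ s₁ m₂ s₂ : ℝ) (h₁ : 0 < s₁) :
    ∫⁻ x, nrm m₁ s₁ (Set.Iic x) * nrm m₂ s₂ (Set.Ioi x)
      = ENNReal.ofReal (val (m₂ - m₁) (√(s₁ ^ 2 + s₂ ^ 2))) := by
  rw [← lint_nrm _ _ (by positivity), ← map_sub_nrm, lintegral_map (by fun_prop) (by fun_prop)]
  have hm : MeasurableSet {q : ℝ × (ℝ × ℝ) | q.2.1 ≤ q.1 ∧ q.1 < q.2.2} :=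
    (measurableSet_le (f := fun q : ℝ × (ℝ × ℝ) => q.2.1) (g := fun q => q.1)
      (by fun_prop) (by fun_prop)).inter
      (measurableSet_lt (f := fun q : ℝ × (ℝ × ℝ) => q.1) (g := fun q => q.2.2)
      (by fun_prop) (by fun_prop))
  have e1 : ∀ x : ℝ, nrm m₁ s₁ (Set.Iic x) * nrm m₂ s₂ (Set.Ioi x)
      = ∫⁻ p, {q : ℝ × (ℝ × ℝ) | q.2.1 ≤ q.1 ∧ q.1 < q.2.2}.indicator 1 (x, p)
        ∂((nrm m₁ s₁).prod (nrm m₂ s₂)) := by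
    intro x
    rw [← Measure.prod_prod, ← lintegral_indicator_one (measurableSet_Iic.prod measurableSet_Ioi)]
    rfl
  simp_rw [e1]
  rw [lintegral_lintegral_swap]
  · congr 1
    ext p
    rw [← Real.volume_Ico, ← lintegral_indicator_one measurableSet_Ico]
    rfl
  · exact (measurable_one.indicator hm).aemeasurable

lemma key_nonneg (y z : ℝ) : 0 ≤ stdNormalCDF y * (1 - stdNormalCDF z) :=
  mul_nonneg (stdCDF_nonneg _) (sub_nonneg.2 (stdCDF_le_one _))

lemma lint_key' (m₁ s₁ m₂ s₂ : ℝ) (h₁ : 0 < s₁) (h₂ : 0 < s₂) :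
    ∫⁻ x, ENNReal.ofReal
      (stdNormalCDF ((x - m₁) / s₁) * (1 - stdNormalCDF ((x - m₂) / s₂)))
      = ENNReal.ofReal (val (m₂ - m₁) (√(s₁ ^ 2 + s₂ ^ 2))) := by
  rw [← lint_key _ _ _ _ h₁]
  congr 1
  ext x
  rw [nrm_Iic _ _ h₁, nrm_Ioi _ _ h₂, ENNReal.ofReal_mul (stdCDF_nonneg _)]

lemma key_meas (m₁ s₁ m₂ s₂ : ℝ) : Measurable fun x =>
    stdNormalCDF ((x - m₁) / s₁) * (1 - stdNormalCDF ((x - m₂) / s₂)) := by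
  have := stdCDF_mono.measurable
  fun_prop

lemma key_integrable (m₁ s₁ m₂ s₂ : ℝ) (h₁ : 0 < s₁) (h₂ : 0 < s₂) :
    Integrable fun x => stdNormalCDF ((x - m₁) / s₁) * (1 - stdNormalCDF ((x - m₂) / s₂)) := by
  refine ⟨(key_meas _ _ _ _).aestronglyMeasurable, ?_⟩
  rw [hasFiniteIntegral_iff_ofReal (Filter.Eventually.of_forall fun _ => key_nonneg _ _),
    lint_key' _ _ _ _ h₁ h₂]
  exact ENNReal.ofReal_lt_top

lemma key_integral (m₁ s₁ m₂ s₂ : ℝ) (h₁ : 0 < s₁) (h₂ : 0 < s₂) :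
    ∫ x, stdNormalCDF ((x - m₁) / s₁) * (1 - stdNormalCDF ((x - m₂) / s₂))
      = val (m₂ - m₁) (√(s₁ ^ 2 + s₂ ^ 2)) := by
  rw [integral_eq_lintegral_of_nonneg_ae (Filter.Eventually.of_forall fun _ => key_nonneg _ _)
    (key_meas _ _ _ _).aestronglyMeasurable, lint_key' _ _ _ _ h₁ h₂,
    ENNReal.toReal_ofReal (val_nonneg _ _ (by positivity))]

theorem integral_F_one_sub_F_normal_mixture (m : ℕ) (hm : 1 ≤ m)
    (w μ σ : Fin m → ℝ) (hw : ∀ j, 0 < w j) (hsum : ∑ j, w j = 1) (hσ : ∀ j, 0 < σ j)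
    (F : ℝ → ℝ) (hF : ∀ x, F x = ∑ j, w j * stdNormalCDF ((x - μ j) / σ j)) :
    ∫ x : ℝ, F x * (1 - F x)
      = ∑ i, ∑ j,
          w i * w j *
            (Real.sqrt (σ i ^ 2 + σ j ^ 2) *
                stdNormalPDF ((μ i - μ j) / Real.sqrt (σ i ^ 2 + σ j ^ 2)) +
              (μ i - μ j) * stdNormalCDF ((μ i - μ j) / Real.sqrt (σ i ^ 2 + σ j ^ 2))) := by
  have e : ∀ x, F x * (1 - F x) = ∑ i, ∑ j, w i * w j *
      (stdNormalCDF ((x - μ j) / σ j) * (1 - stdNormalCDF ((x - μ i) / σ i))) := by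
    intro x
    have h1 : 1 - F x = ∑ i, w i * (1 - stdNormalCDF ((x - μ i) / σ i)) := by
      simp only [mul_sub, Finset.sum_sub_distrib, mul_one, hsum, hF]
    rw [h1, hF, mul_comm, Finset.sum_mul_sum]
    refine Finset.sum_congr rfl fun i _ => Finset.sum_congr rfl fun j _ => ?_
    ring
  simp_rw [e]
  have hi := fun i j : Fin m =>
    (key_integrable (μ j) (σ j) (μ i) (σ i) (hσ j) (hσ i)).const_mul (w i * w j)
  rw [integral_finsetSum _ fun i _ => integrable_finsetSum _ fun j _ => hi i j]
  refine Finset.sum_congr rfl fun i _ => ?_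
  rw [integral_finsetSum _ fun j _ => hi i j]
  refine Finset.sum_congr rfl fun j _ => ?_
  rw [integral_const_mul, key_integral _ _ _ _ (hσ j) (hσ i), add_comm (σ j ^ 2)]
  rfl
end
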